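/- arXiv:nlin/0512001 — 2 statements merged into one kernel-verified Lean document; each statement's English description precedes it below -/
import Mathlib

section
/- Let u¹, u² : ℝ² → ℝ be smooth solutions of the G₂ Toda lattice ∂²u¹/∂x∂y = 2e^{u¹} − e^{u²}, ∂²u²/∂x∂y = −3e^{u¹} + 2e^{u²}. Let B₂, B₃, B₄, B₅ : ℝ² → M₂(ℝ) be any smooth matrix functions whose second column vanishes identically. With the notation G₂ = [[2,−1],[−3,2]], P = [[3,1],[0,1/3]], Q = [[1,0],[−1,1]], U = diag(e^{u¹}, e^{u²}), R₁ = diag(∂_yu¹, ∂_yu²), R₂ = diag(0, ∂_yu¹+∂_yu²), R₃ = diag(0, 2∂_yu¹+∂_yu²), R₄ = diag(0, 3∂_yu¹+∂_yu²), R₅ = diag(0, 3∂_yu¹+2∂_yu²), define recursively: H₁ = X₁ = G₂·U, a₁ = −G₂R₁G₂⁻¹, and for m = 2,…,5: a_m = (−G₂P⁻¹R_m + B_m)PG₂⁻¹, H_{m+1} = ∂_x(a_m) + H_m, X_{m+1} = H_{m+1}·X_m (derivatives entrywise). Then X₂ = G₂P⁻¹·diag(0, e^{u¹+u²})·Q,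 X₃ = G₂P⁻¹·diag(0, 4e^{2u¹+u²})·Q, X₄ = G₂P⁻¹·diag(0, 12e^{3u¹+u²})·Q, X₅ = G₂P⁻¹·diag(0, 12e^{3u¹+2u²})·Q, and X₆ = 0. In particular the X_m are independent of the choice of B₂,…,B₅, and the chain of generalized Laplace invariants of the G₂ Toda lattice terminates at m = 6. -/
open Matrix

noncomputable section

/-- Entrywise partial derivative with respect to the first variable `x`. -/
def dxMat {n : ℕ} (F : ℝ × ℝ → Matrix (Fin n) (Fin n) ℝ) (p : ℝ × ℝ) :
    Matrix (Fin n) (Fin n) ℝ :=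
  Matrix.of fun i j => deriv (fun s => F (s, p.2) i j) p.1

/-- Partial derivative of a scalar function with respect to `y`. -/
def dy (f : ℝ × ℝ → ℝ) (p : ℝ × ℝ) : ℝ := deriv (fun t => f (p.1, t)) p.2

/-- The Cartan matrix `G₂`. -/
def G2M : Matrix (Fin 2) (Fin 2) ℝ := !![2, -1; -3, 2]

def PM : Matrix (Fin 2) (Fin 2) ℝ := !![3, 1; 0, 1/3]

def QM : Matrix (Fin 2) (Fin 2) ℝ := !![1, 0; -1, 1]

/-- The diagonal matrices `R_m`, `m = 2,…,5`, for the `G₂` Toda lattice. -/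
def Rg2 (u1 u2 : ℝ × ℝ → ℝ) (m : ℕ) (p : ℝ × ℝ) : Matrix (Fin 2) (Fin 2) ℝ :=
  match m with
  | 2 => Matrix.diagonal ![0, dy u1 p + dy u2 p]
  | 3 => Matrix.diagonal ![0, 2 * dy u1 p + dy u2 p]
  | 4 => Matrix.diagonal ![0, 3 * dy u1 p + dy u2 p]
  | 5 => Matrix.diagonal ![0, 3 * dy u1 p + 2 * dy u2 p]
  | _ => 0

lemma inv_G2M : G2M⁻¹ = !![2, 1; 3, 2] := by
  refine inv_eq_right_inv ?_
  ext i j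
  fin_cases i <;> fin_cases j <;> norm_num [G2M]

lemma inv_PM : PM⁻¹ = !![1 / 3, -1; 0, 3] := by
  refine inv_eq_right_inv ?_
  ext i j
  fin_cases i <;> fin_cases j <;> norm_num [PM]

/-- The vector `![-5, 9]` is the second column of `G2M * PM⁻¹`; it is a common eigenvector of
the `H m` with `2 ≤ m`. -/
lemma G2M_mul_inv_PM_mul_diagonal_mul_QM (f : ℝ) :
    G2M * PM⁻¹ * diagonal ![0, f] * QM = f • vecMulVec ![-5, 9] ![-1, 1] := by
  rw [inv_PM]
  ext i j
  fin_cases i <;> fin_cases j <;>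
    simp [G2M, QM, diagonal_vec2] <;> ring

lemma contDiff_dy {u : ℝ × ℝ → ℝ} (hu : ContDiff ℝ (⊤ : ℕ∞) u) :
    ContDiff ℝ (⊤ : ℕ∞) (dy u) := by
  have h : dy u = fun p => fderiv ℝ u p (0, 1) := by
    funext p
    have hd : HasFDerivAt u (fderiv ℝ u p) (p.1, p.2) :=
      ((hu.differentiable (by simp)) p).hasFDerivAt
    exact (hd.comp_hasDerivAt p.2 ((hasDerivAt_const p.2 p.1).prodMk (hasDerivAt_id p.2))).deriv
  rw [h]
  exact (hu.fderiv_right (by simp)).clm_apply contDiff_const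

lemma hasDerivAt_dy {u : ℝ × ℝ → ℝ} (hu : ContDiff ℝ (⊤ : ℕ∞) u) {p : ℝ × ℝ} {d : ℝ}
    (hd : deriv (fun s => deriv (fun t => u (s, t)) p.2) p.1 = d) :
    HasDerivAt (fun s => dy u (s, p.2)) d p.1 := by
  have h : Differentiable ℝ (dy u) := (contDiff_dy hu).differentiable (by simp)
  rw [← hd]
  exact (show DifferentiableAt ℝ (fun s => dy u (s, p.2)) p.1 by fun_prop).hasDerivAt

lemma dxMat_mulVec {n : ℕ} {F : ℝ × ℝ → Matrix (Fin n) (Fin n) ℝ} {p : ℝ × ℝ}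
    {v w : Fin n → ℝ} (hF : ∀ i j, DifferentiableAt ℝ (fun s => F (s, p.2) i j) p.1)
    (hw : ∀ i, HasDerivAt (fun s => (F (s, p.2) *ᵥ v) i) (w i) p.1) :
    dxMat F p *ᵥ v = w := by
  funext i
  refine HasDerivAt.unique ?_ (hw i)
  simp only [mulVec, dotProduct, dxMat, of_apply]
  exact HasDerivAt.fun_sum fun j _ => (hF i j).hasDerivAt.mul_const (v j)

lemma dxMat_gauge_mulVec {A C : ℝ × ℝ → Matrix (Fin 2) (Fin 2) ℝ} {r : ℝ × ℝ → ℝ}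
    (hC : ∀ i j, Differentiable ℝ (fun p => C p i j)) (hcol : ∀ p i, C p i 1 = 0)
    (hA : ∀ p, A p = (-(G2M * PM⁻¹ * diagonal ![0, r p]) + C p) * PM * G2M⁻¹)
    {p : ℝ × ℝ} {d : ℝ} (hr : HasDerivAt (fun s => r (s, p.2)) d p.1) :
    dxMat A p *ᵥ ![-5, 9] = (-d) • ![-5, 9] := by
  have hA' (p) : A p = !![9 * C p 0 0 + 5 * r p, 5 * C p 0 0 + 10 / 3 * r p;
      9 * C p 1 0 - 9 * r p, 5 * C p 1 0 - 6 * r p] := by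
    rw [hA, inv_G2M, inv_PM, eta_fin_two (C p), hcol, hcol]
    ext i j
    fin_cases i <;> fin_cases j <;> simp [G2M, PM, diagonal_vec2] <;> ring
  refine dxMat_mulVec (fun i j => ?_) (fun i => ?_)
  · have hr' := hr.differentiableAt
    have hC' (i) : DifferentiableAt ℝ (fun s => C (s, p.2) i 0) p.1 :=
      DifferentiableAt.comp (g := fun q => C q i 0) (f := fun s => (s, p.2)) p.1 (hC i 0 _)
        (by fun_prop)
    simp only [hA']
    fin_cases i <;> fin_cases j
    · exact ((hC' 0).const_mul 9).add (hr'.const_mul 5)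
    · exact ((hC' 0).const_mul 5).add (hr'.const_mul (10 / 3))
    · exact ((hC' 1).const_mul 9).sub (hr'.const_mul 9)
    · exact ((hC' 1).const_mul 5).sub (hr'.const_mul 6)
  · have h (s) : (A (s, p.2) *ᵥ ![-5, 9]) i =
        -r (s, p.2) * (![-5, 9] : Fin 2 → ℝ) i := by
      rw [hA']
      fin_cases i <;> simp <;> ring
    simp only [h]
    exact hr.neg.mul_const _

lemma dxMat_conj_diagonal {A : ℝ × ℝ → Matrix (Fin 2) (Fin 2) ℝ} {r₁ r₂ : ℝ × ℝ → ℝ}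
    (hA : ∀ p, A p = -(G2M * diagonal ![r₁ p, r₂ p] * G2M⁻¹))
    {p : ℝ × ℝ} {d₁ d₂ : ℝ} (h₁ : HasDerivAt (fun s => r₁ (s, p.2)) d₁ p.1)
    (h₂ : HasDerivAt (fun s => r₂ (s, p.2)) d₂ p.1) :
    dxMat A p = -(G2M * diagonal ![d₁, d₂] * G2M⁻¹) := by
  have h (i j : Fin 2) (x y : ℝ) : (-(G2M * diagonal ![x, y] * G2M⁻¹)) i j =
      -(x * (G2M i 0 * G2M⁻¹ 0 j) + y * (G2M i 1 * G2M⁻¹ 1 j)) := by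
    rw [neg_apply, mul_apply, Fin.sum_univ_two]
    simp only [mul_diagonal, cons_val_zero, cons_val_one]
    ring
  ext i j
  simp only [dxMat, of_apply, hA, h]
  exact ((h₁.mul_const _).add (h₂.mul_const _)).neg.deriv

/-- **The chain of generalized Laplace invariants of the `G₂` Toda lattice.**
For any choice of the admissible matrices `B₂,…,B₅` (smooth, second column zero),
the recursively defined invariants satisfy the explicit formulas, and `X₆ = 0`:
the chain terminates at the Coxeter number `6` of `G₂`. -/
theorem g2_laplace_chain_terminates
    (u1 u2 : ℝ × ℝ → ℝ) (hu1 : ContDiff ℝ (⊤ : ℕ∞) u1) (hu2 : ContDiff ℝ (⊤ : ℕ∞) u2)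
    (hpde1 : ∀ x y : ℝ, deriv (fun s => deriv (fun t => u1 (s, t)) y) x =
      2 * Real.exp (u1 (x, y)) - Real.exp (u2 (x, y)))
    (hpde2 : ∀ x y : ℝ, deriv (fun s => deriv (fun t => u2 (s, t)) y) x =
      -3 * Real.exp (u1 (x, y)) + 2 * Real.exp (u2 (x, y)))
    (B : ℕ → ℝ × ℝ → Matrix (Fin 2) (Fin 2) ℝ)
    (hBsmooth : ∀ m, 2 ≤ m → m ≤ 5 → ∀ i j : Fin 2, ContDiff ℝ (⊤ : ℕ∞) (fun p => B m p i j))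
    (hBcol : ∀ m, 2 ≤ m → m ≤ 5 → ∀ (p : ℝ × ℝ) (i : Fin 2), B m p i 1 = 0)
    (a H X : ℕ → ℝ × ℝ → Matrix (Fin 2) (Fin 2) ℝ)
    (hH1 : ∀ p, H 1 p = G2M * Matrix.diagonal ![Real.exp (u1 p), Real.exp (u2 p)])
    (hX1 : ∀ p, X 1 p = G2M * Matrix.diagonal ![Real.exp (u1 p), Real.exp (u2 p)])
    (ha1 : ∀ p, a 1 p = -(G2M * Matrix.diagonal ![dy u1 p, dy u2 p] * G2M⁻¹))
    (ham : ∀ m, 2 ≤ m → m ≤ 5 → ∀ p,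
      a m p = (-(G2M * PM⁻¹ * Rg2 u1 u2 m p) + B m p) * PM * G2M⁻¹)
    (hHrec : ∀ m, 1 ≤ m → m ≤ 5 → ∀ p, H (m + 1) p = dxMat (a m) p + H m p)
    (hXrec : ∀ m, 1 ≤ m → m ≤ 5 → ∀ p, X (m + 1) p = H (m + 1) p * X m p) :
    (∀ p, X 2 p = G2M * PM⁻¹ * Matrix.diagonal ![0, Real.exp (u1 p + u2 p)] * QM) ∧
    (∀ p, X 3 p = G2M * PM⁻¹ * Matrix.diagonal ![0, 4 * Real.exp (2 * u1 p + u2 p)] * QM) ∧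
    (∀ p, X 4 p = G2M * PM⁻¹ * Matrix.diagonal ![0, 12 * Real.exp (3 * u1 p + u2 p)] * QM) ∧
    (∀ p, X 5 p = G2M * PM⁻¹ * Matrix.diagonal ![0, 12 * Real.exp (3 * u1 p + 2 * u2 p)] * QM) ∧
    (∀ p, X 6 p = 0) := by
  have hd1 (p : ℝ × ℝ) := hasDerivAt_dy hu1 (hpde1 p.1 p.2)
  have hd2 (p : ℝ × ℝ) := hasDerivAt_dy hu2 (hpde2 p.1 p.2)
  have hH2 (p) : H 2 p = _ := (hHrec 1 le_rfl (by norm_num) p).trans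
    (congrArg₂ (· + ·) (dxMat_conj_diagonal ha1 (hd1 p) (hd2 p)) (hH1 p))
  have hX2 (p) : X 2 p = Real.exp (u1 p + u2 p) • vecMulVec ![-5, 9] ![-1, 1] := by
    rw [hXrec 1 le_rfl (by norm_num), hH2, hX1, inv_G2M, Real.exp_add]
    ext i j
    fin_cases i <;> fin_cases j <;>
      simp [G2M, diagonal_vec2] <;> ring
  have hv2 (p) : H 2 p *ᵥ ![-5, 9] =
      (3 * Real.exp (u1 p) + Real.exp (u2 p)) • ![-5, 9] := by
    rw [hH2, inv_G2M]
    ext i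
    fin_cases i <;>
      simp [G2M, diagonal_vec2] <;> ring
  have hstep (m : ℕ) (hm : 2 ≤ m) (hm' : m ≤ 5) (r : ℝ × ℝ → ℝ)
      (hr : ∀ p, Rg2 u1 u2 m p = diagonal ![0, r p]) (p : ℝ × ℝ) {d k l : ℝ}
      (hd : HasDerivAt (fun s => r (s, p.2)) d p.1)
      (hk : H m p *ᵥ ![-5, 9] = k • ![-5, 9]) (hl : k - d = l) :
      H (m + 1) p *ᵥ ![-5, 9] = l • ![-5, 9] := by
    have hB (i j) : Differentiable ℝ (fun p => B m p i j) :=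
      (hBsmooth m hm hm' i j).differentiable (by simp)
    rw [hHrec m (by lia) hm', add_mulVec, hk, dxMat_gauge_mulVec hB (hBcol m hm hm')
      (fun p => by rw [ham m hm hm', hr]) hd, ← add_smul, ← hl, neg_add_eq_sub]
  have hv3 (p) : H 3 p *ᵥ ![-5, 9] = (4 * Real.exp (u1 p)) • ![-5, 9] :=
    hstep 2 (by norm_num) (by norm_num) _ (fun _ => rfl) p ((hd1 p).add (hd2 p)) (hv2 p) (by ring)
  have hv4 (p) : H 4 p *ᵥ ![-5, 9] = (3 * Real.exp (u1 p)) • ![-5, 9] :=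
    hstep 3 (by norm_num) (by norm_num) _ (fun _ => rfl) p (((hd1 p).const_mul 2).add (hd2 p))
      (hv3 p) (by ring)
  have hv5 (p) : H 5 p *ᵥ ![-5, 9] = Real.exp (u2 p) • ![-5, 9] :=
    hstep 4 (by norm_num) (by norm_num) _ (fun _ => rfl) p (((hd1 p).const_mul 3).add (hd2 p))
      (hv4 p) (by ring)
  have hv6 (p) : H 6 p *ᵥ ![-5, 9] = (0 : ℝ) • ![-5, 9] :=
    hstep 5 (by norm_num) (by norm_num) _ (fun _ => rfl) p
      (((hd1 p).const_mul 3).add ((hd2 p).const_mul 2)) (hv5 p) (by ring)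
  have hXstep (m : ℕ) (hm : 1 ≤ m) (hm' : m ≤ 5) (p : ℝ × ℝ) {f k g : ℝ}
      (hX : X m p = f • vecMulVec ![-5, 9] ![-1, 1])
      (hk : H (m + 1) p *ᵥ ![-5, 9] = k • ![-5, 9]) (hg : f * k = g) :
      X (m + 1) p = g • vecMulVec ![-5, 9] ![-1, 1] := by
    rw [hXrec m hm hm', hX, mul_smul_comm, mul_vecMulVec, hk, smul_vecMulVec, smul_smul, hg]
  have hX3 (p) : X 3 p = (4 * Real.exp (2 * u1 p + u2 p)) • vecMulVec ![-5, 9] ![-1, 1] :=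
    hXstep 2 (by norm_num) (by norm_num) p (hX2 p) (hv3 p) (by
      rw [mul_left_comm, ← Real.exp_add]; ring_nf)
  have hX4 (p) : X 4 p = (12 * Real.exp (3 * u1 p + u2 p)) • vecMulVec ![-5, 9] ![-1, 1] :=
    hXstep 3 (by norm_num) (by norm_num) p (hX3 p) (hv4 p) (by
      rw [mul_mul_mul_comm, ← Real.exp_add]; ring_nf)
  have hX5 (p) : X 5 p = (12 * Real.exp (3 * u1 p + 2 * u2 p)) • vecMulVec ![-5, 9] ![-1, 1] :=
    hXstep 4 (by norm_num) (by norm_num) p (hX4 p) (hv5 p) (by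
      rw [mul_assoc, ← Real.exp_add]; ring_nf)
  have hX6 (p) : X 6 p = (0 : ℝ) • vecMulVec ![-5, 9] ![-1, 1] :=
    hXstep 5 (by norm_num) (by norm_num) p (hX5 p) (hv6 p) (mul_zero _)
  simp only [G2M_mul_inv_PM_mul_diagonal_mul_QM]
  exact ⟨hX2, hX3, hX4, hX5, fun p => by rw [hX6, zero_smul]⟩

end
end

section
/- Let u¹, u², u³, u⁴ : ℝ² → ℝ be smooth solutions of the F₄ Toda lattice: u¹_xy = 2e^{u¹} − e^{u²}, u²_xy = −e^{u¹} + 2e^{u²} − e^{u³}, u³_xy = −2e^{u²} + 2e^{u³} − e^{u⁴}, u⁴_xy = −e^{u³} + 2e^{u⁴}. With F₄ = [[2,−1,0,0],[−1,2,−1,0],[0,−2,2,−1],[0,0,−1,2]], J̃ = [[2,2,1,1],[0,2,1,1],[0,0,1,1],[0,0,0,1]], J₄ the 4×4 upper-triangular matrix with all entries on and above the diagonal equal to 1, U = diag(e^{u¹},…,e^{u⁴}), R₁ = diag(∂_yu¹,…,∂_yu⁴), Z₂ = [[0,0,0,0],[−2e^{u²}, 2e^{u¹}, 0, 0],[0,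 −2e^{u³}, 2e^{u²}, 0],[0, 0, −e^{u⁴}, e^{u³}]] and S₂ = diag(0, 2e^{u¹+u²}, 2e^{u²+u³}, e^{u³+u⁴}), define H₂ := ∂_x(−F₄·R₁·F₄⁻¹) + F₄·U (∂_x entrywise). Then at every point H₂ = F₄·J̃⁻¹·Z₂·F₄⁻¹, X₂ := H₂·(F₄·U) = F₄·J̃⁻¹·S₂·(J₄⁻¹)ᵀ, and X₂(x,y) has rank 3 for all (x,y). -/
open Matrix

noncomputable section

/-- The Cartan matrix `F₄`. -/
def F4M : Matrix (Fin 4) (Fin 4) ℝ :=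
  !![2, -1, 0, 0; -1, 2, -1, 0; 0, -2, 2, -1; 0, 0, -1, 2]

/-- The matrix `J̃`. -/
def Jt : Matrix (Fin 4) (Fin 4) ℝ :=
  !![2, 2, 1, 1; 0, 2, 1, 1; 0, 0, 1, 1; 0, 0, 0, 1]

/-- The `4 × 4` upper-triangular all-ones matrix `J₄`. -/
def J4 : Matrix (Fin 4) (Fin 4) ℝ :=
  !![1, 1, 1, 1; 0, 1, 1, 1; 0, 0, 1, 1; 0, 0, 0, 1]

/-- A partial derivative in `y` of a smooth function is differentiable in `x`. -/
theorem differentiable_dy_left {u : ℝ × ℝ → ℝ} (hu : ContDiff ℝ (⊤ : ℕ∞) u) (y : ℝ) :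
    Differentiable ℝ fun s => dy u (s, y) := by
  have key : (fun s => dy u (s, y)) = fun s => fderiv ℝ u (s, y) (0, 1) := by
    funext s
    have hline : HasDerivAt (fun t : ℝ => (s, t)) ((0 : ℝ), (1 : ℝ)) y :=
      (hasDerivAt_const y s).prodMk (hasDerivAt_id y)
    have hdiff : HasFDerivAt u (fderiv ℝ u (s, y)) (s, y) :=
      (hu.differentiable (by simp) (s, y)).hasFDerivAt
    exact (hdiff.comp_hasDerivAt y hline).deriv
  rw [key]
  have hf : Differentiable ℝ (fderiv ℝ u) :=
    (hu.fderiv_right (m := 1) (by norm_cast)).differentiable one_ne_zero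
  have hc : Differentiable ℝ fun s : ℝ => fderiv ℝ u (s, y) :=
    hf.comp (differentiable_id.prodMk (differentiable_const y))
  exact hc.clm_apply (differentiable_const _)

/-- Entrywise differentiation commutes with conjugation-type products by constant matrices. -/
theorem dxMat_neg_mul_diagonal_mul {n : ℕ} (A B : Matrix (Fin n) (Fin n) ℝ)
    (d : ℝ × ℝ → Fin n → ℝ) (e : Fin n → ℝ) (p : ℝ × ℝ)
    (h : ∀ i, HasDerivAt (fun s => d (s, p.2) i) (e i) p.1) :
    dxMat (fun q => -(A * diagonal (d q) * B)) p = -(A * diagonal e * B) := by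
  ext i j
  simp only [dxMat, of_apply, Matrix.neg_apply, mul_apply (M := A * _), mul_diagonal]
  exact (HasDerivAt.fun_sum fun k _ => ((h k).const_mul (A i k)).mul_const (B k j)).neg.deriv

theorem isUnit_det_F4M : IsUnit F4M.det := by
  simp [F4M, det_succ_row_zero, Fin.sum_univ_succ, Fin.succAbove]
  norm_num

theorem isUnit_det_Jt : IsUnit Jt.det := by
  simp [Jt, det_succ_row_zero, Fin.sum_univ_succ, Fin.succAbove]

theorem isUnit_det_J4 : IsUnit J4.det := by
  simp [J4, det_succ_row_zero, Fin.sum_univ_succ, Fin.succAbove]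

theorem J4_inv : J4⁻¹ = !![1, -1, 0, 0; 0, 1, -1, 0; 0, 0, 1, -1; 0, 0, 0, 1] := by
  refine inv_eq_right_inv ?_
  ext i j
  fin_cases i <;> fin_cases j <;> simp [J4, mul_apply, Fin.sum_univ_succ]

theorem diagonal_mul_F4M_sub (a b c d : ℝ) :
    diagonal ![a, b, c, d] * F4M -
        diagonal ![2 * a - b, -a + 2 * b - c, -2 * b + 2 * c - d, -c + 2 * d] =
      Jt⁻¹ * !![0, 0, 0, 0; -2 * b, 2 * a, 0, 0; 0, -2 * c, 2 * b, 0; 0, 0, -d, c] := by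
  have h : Jt * (diagonal ![a, b, c, d] * F4M -
        diagonal ![2 * a - b, -a + 2 * b - c, -2 * b + 2 * c - d, -c + 2 * d]) =
      !![0, 0, 0, 0; -2 * b, 2 * a, 0, 0; 0, -2 * c, 2 * b, 0; 0, 0, -d, c] := by
    ext i j
    fin_cases i <;> fin_cases j <;>
      simp [Jt, F4M, mul_apply (M := !![_, _, _, _; _, _, _, _; _, _, _, _; _, _, _, _]),
        Fin.sum_univ_succ, diagonal_mul, diagonal_apply] <;> ring
  rw [← h, nonsing_inv_mul_cancel_left _ _ isUnit_det_Jt]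

theorem bidiagonal_mul_diagonal (a b c d : ℝ) :
    !![0, 0, 0, 0; -2 * b, 2 * a, 0, 0; 0, -2 * c, 2 * b, 0; 0, 0, -d, c] *
        diagonal ![a, b, c, d] =
      diagonal ![0, 2 * (a * b), 2 * (b * c), c * d] * (J4⁻¹)ᵀ := by
  rw [J4_inv]
  ext i j
  fin_cases i <;> fin_cases j <;> simp [mul_diagonal, diagonal_mul] <;> ring

theorem rank_diagonal_zero_cons {a b c : ℝ} (ha : a ≠ 0) (hb : b ≠ 0) (hc : c ≠ 0) :
    (diagonal ![0, a, b, c]).rank = 3 := by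
  classical
  rw [rank_diagonal, Fintype.card_subtype]
  have : (Finset.univ.filter fun i => (![0, a, b, c] : Fin 4 → ℝ) i ≠ 0) = {1, 2, 3} := by
    ext i
    fin_cases i <;> simp [ha, hb, hc]
  rw [this]
  rfl

/-- For smooth solutions of the `F₄` Toda lattice, `H₂ = ∂_x(−F₄R₁F₄⁻¹) + F₄U`
equals `F₄J̃⁻¹Z₂F₄⁻¹`, `X₂ = H₂·(F₄U) = F₄J̃⁻¹S₂(J₄⁻¹)ᵀ`, and `X₂` has rank `3`. -/
theorem f4_second_laplace_invariant
    (u1 u2 u3 u4 : ℝ × ℝ → ℝ)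
    (hu1 : ContDiff ℝ (⊤ : ℕ∞) u1) (hu2 : ContDiff ℝ (⊤ : ℕ∞) u2)
    (hu3 : ContDiff ℝ (⊤ : ℕ∞) u3) (hu4 : ContDiff ℝ (⊤ : ℕ∞) u4)
    (hpde1 : ∀ x y : ℝ, deriv (fun s => deriv (fun t => u1 (s, t)) y) x =
      2 * Real.exp (u1 (x, y)) - Real.exp (u2 (x, y)))
    (hpde2 : ∀ x y : ℝ, deriv (fun s => deriv (fun t => u2 (s, t)) y) x =
      -Real.exp (u1 (x, y)) + 2 * Real.exp (u2 (x, y)) - Real.exp (u3 (x, y)))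
    (hpde3 : ∀ x y : ℝ, deriv (fun s => deriv (fun t => u3 (s, t)) y) x =
      -2 * Real.exp (u2 (x, y)) + 2 * Real.exp (u3 (x, y)) - Real.exp (u4 (x, y)))
    (hpde4 : ∀ x y : ℝ, deriv (fun s => deriv (fun t => u4 (s, t)) y) x =
      -Real.exp (u3 (x, y)) + 2 * Real.exp (u4 (x, y))) :
    ∀ p : ℝ × ℝ,
      dxMat (fun q =>
          -(F4M * Matrix.diagonal ![dy u1 q, dy u2 q, dy u3 q, dy u4 q] * F4M⁻¹)) p +
          F4M * Matrix.diagonal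
            ![Real.exp (u1 p), Real.exp (u2 p), Real.exp (u3 p), Real.exp (u4 p)] =
        F4M * Jt⁻¹ *
          !![0, 0, 0, 0;
             -2 * Real.exp (u2 p), 2 * Real.exp (u1 p), 0, 0;
             0, -2 * Real.exp (u3 p), 2 * Real.exp (u2 p), 0;
             0, 0, -Real.exp (u4 p), Real.exp (u3 p)] * F4M⁻¹ ∧
      (dxMat (fun q =>
          -(F4M * Matrix.diagonal ![dy u1 q, dy u2 q, dy u3 q, dy u4 q] * F4M⁻¹)) p +
          F4M * Matrix.diagonal
            ![Real.exp (u1 p), Real.exp (u2 p), Real.exp (u3 p), Real.exp (u4 p)]) *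
          (F4M * Matrix.diagonal
            ![Real.exp (u1 p), Real.exp (u2 p), Real.exp (u3 p), Real.exp (u4 p)]) =
        F4M * Jt⁻¹ *
          Matrix.diagonal ![0, 2 * Real.exp (u1 p + u2 p), 2 * Real.exp (u2 p + u3 p),
            Real.exp (u3 p + u4 p)] * (J4⁻¹)ᵀ ∧
      (F4M * Jt⁻¹ *
          Matrix.diagonal ![0, 2 * Real.exp (u1 p + u2 p), 2 * Real.exp (u2 p + u3 p),
            Real.exp (u3 p + u4 p)] * (J4⁻¹)ᵀ).rank = 3 := by
  intro p
  have hH := dxMat_neg_mul_diagonal_mul F4M F4M⁻¹ (fun q => ![dy u1 q, dy u2 q, dy u3 q, dy u4 q])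
    ![2 * Real.exp (u1 p) - Real.exp (u2 p),
      -Real.exp (u1 p) + 2 * Real.exp (u2 p) - Real.exp (u3 p),
      -2 * Real.exp (u2 p) + 2 * Real.exp (u3 p) - Real.exp (u4 p),
      -Real.exp (u3 p) + 2 * Real.exp (u4 p)] p (by
    intro i
    fin_cases i
    · exact hpde1 p.1 p.2 ▸ (differentiable_dy_left hu1 p.2 p.1).hasDerivAt
    · exact hpde2 p.1 p.2 ▸ (differentiable_dy_left hu2 p.2 p.1).hasDerivAt
    · exact hpde3 p.1 p.2 ▸ (differentiable_dy_left hu3 p.2 p.1).hasDerivAt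
    · exact hpde4 p.1 p.2 ▸ (differentiable_dy_left hu4 p.2 p.1).hasDerivAt)
  have hH₂ : ∀ D U : Matrix (Fin 4) (Fin 4) ℝ,
      -(F4M * D * F4M⁻¹) + F4M * U = F4M * (U * F4M - D) * F4M⁻¹ := by
    intro D U
    rw [Matrix.mul_sub, Matrix.sub_mul, ← Matrix.mul_assoc F4M U F4M,
      mul_nonsing_inv_cancel_right _ _ isUnit_det_F4M]
    abel
  rw [hH, hH₂, diagonal_mul_F4M_sub, ← Matrix.mul_assoc F4M]
  refine ⟨rfl, ?_, ?_⟩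
  · rw [← Matrix.mul_assoc _ F4M, nonsing_inv_mul_cancel_right _ _ isUnit_det_F4M,
      Matrix.mul_assoc (F4M * Jt⁻¹), bidiagonal_mul_diagonal, ← Matrix.mul_assoc (F4M * Jt⁻¹)]
    simp only [Real.exp_add]
  · have hJ4 : IsUnit (J4⁻¹)ᵀ.det := by
      rw [det_transpose]
      exact isUnit_nonsing_inv_det _ isUnit_det_J4
    have hFJ : IsUnit (F4M * Jt⁻¹).det := by
      rw [det_mul]
      exact isUnit_det_F4M.mul (isUnit_nonsing_inv_det _ isUnit_det_Jt)
    rw [rank_mul_eq_left_of_isUnit_det _ _ hJ4, rank_mul_eq_right_of_isUnit_det _ _ hFJ]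
    exact rank_diagonal_zero_cons (by positivity) (by positivity) (by positivity)

end
end
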